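/- Let T = V₁ − V₂, where V₁ and V₂ are independent, each with the (central) chi-square distribution χ'²_r(0), r > 0, and let W be a real-valued random variable with E|W| < ∞. Define the operator A₃ by A₃f(x) = 4x f″(x) + 4r f′(x) − x f(x). Then W has the same distribution as T if and only if E[A₃f(W)] = 0 for all f ∈ F₂(W). -/

import Mathlib

open MeasureTheory ProbabilityTheory Real

noncomputable section

/-- Modified Bessel function of the first kind,
`I ν y = ∑_{k=0}^∞ (y/2)^{2k+ν} / (k! Γ(k+ν+1))`. -/
def besselI (ν y : ℝ) : ℝ :=
  ∑' k : ℕ, (y / 2) ^ (2 * (k : ℝ) + ν) / ((k.factorial : ℝ) * Real.Gamma ((k : ℝ) + ν + 1))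

/-- The density of the noncentral chi-square distribution with `r` degrees of freedom and
noncentrality parameter `lam` (for `lam = 0`, the chi-square density). -/
def ncChiSqPdf (r lam x : ℝ) : ℝ :=
  if x ≤ 0 then 0
  else if lam = 0 then x ^ (r / 2 - 1) * Real.exp (-x / 2) / (2 ^ (r / 2) * Real.Gamma (r / 2))
  else (1 / 2) * Real.exp (-(x + lam) / 2) * (x / lam) ^ (r / 4 - 1 / 2) *
    besselI (r / 2 - 1) (Real.sqrt (lam * x))

/-- The noncentral chi-square distribution `χ'²_r(lam)` as a measure on `ℝ`. -/
def ncChiSq (r lam : ℝ) : Measure ℝ :=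
  volume.withDensity fun x => ENNReal.ofReal (ncChiSqPdf r lam x)

/-- The law of the difference `T = V₁ - V₂` of independent noncentral chi-square random
variables `V₁ ~ χ'²_r(λ₁)` and `V₂ ~ χ'²_r(λ₂)`. -/
def ncChiSqDiff (r lam1 lam2 : ℝ) : Measure ℝ :=
  Measure.map (fun p : ℝ × ℝ => p.1 - p.2) ((ncChiSq r lam1).prod (ncChiSq r lam2))

/-- The unnormalised chi-square weight is integrable on `(0, ∞)`. -/
lemma integrableOn_rpow_mul_exp_neg_half {s : ℝ} (hs : -1 < s) :
    IntegrableOn (fun x : ℝ => x ^ s * exp (-(1 / 2) * x)) (Set.Ioi 0) := by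
  have h := integrableOn_rpow_mul_exp_neg_mul_rpow (p := 1) (b := 1 / 2) hs one_pos (by norm_num)
  simpa only [rpow_one] using h

lemma ncChiSq_eq_gammaMeasure (r : ℝ) : ncChiSq r 0 = gammaMeasure (r / 2) (1 / 2) := by
  refine withDensity_congr_ae ?_
  have h0 : ∀ᵐ x : ℝ, x ≠ 0 := by simp [ae_iff]
  filter_upwards [h0] with x hx
  rw [gammaPDF]
  congr 1
  rcases lt_or_gt_of_ne hx with h | h
  · simp [ncChiSqPdf, gammaPDFReal, h.le, not_le.mpr h]
  · simp only [ncChiSqPdf, gammaPDFReal, not_le.mpr h, h.le, if_true, if_false]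
    rw [show -x / 2 = -(1 / 2 * x) by ring, one_div, inv_rpow (by norm_num)]
    field_simp

lemma isProbabilityMeasure_ncChiSq {r : ℝ} (hr : 0 < r) : IsProbabilityMeasure (ncChiSq r 0) := by
  rw [ncChiSq_eq_gammaMeasure]
  exact isProbabilityMeasure_gammaMeasure (by positivity) (by norm_num)

lemma gammaPDFReal_smul_eq_indicator {r : ℝ} (hr : 0 < r) (h : ℝ → ℝ) :
    (fun x => (gammaPDF (r / 2) (1 / 2) x).toReal • h x) =ᵐ[volume]
      (Set.Ioi 0).indicator fun x => ((1 / 2) ^ (r / 2) / Gamma (r / 2)) *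
        (x ^ (r / 2 - 1) * exp (-(1 / 2) * x) * h x) := by
  have h0 : ∀ᵐ x : ℝ, x ≠ 0 := by simp [ae_iff]
  filter_upwards [h0] with x hx
  rw [gammaPDF, ENNReal.toReal_ofReal (gammaPDFReal_nonneg (by positivity) (by norm_num) x)]
  rcases lt_or_gt_of_ne hx with h | h
  · rw [Set.indicator_of_notMem (by simpa using h.le)]
    simp [gammaPDFReal, not_le.mpr h]
  · rw [Set.indicator_of_mem (by simpa using h)]
    simp only [gammaPDFReal, h.le, if_true, smul_eq_mul]
    rw [neg_mul]
    ring

lemma integral_ncChiSq {r : ℝ} (hr : 0 < r) (h : ℝ → ℝ) :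
    ∫ x, h x ∂(ncChiSq r 0) = ((1 / 2) ^ (r / 2) / Gamma (r / 2)) *
      ∫ x in Set.Ioi 0, x ^ (r / 2 - 1) * exp (-(1 / 2) * x) * h x := by
  rw [ncChiSq_eq_gammaMeasure, gammaMeasure, integral_withDensity_eq_integral_toReal_smul
    (f := gammaPDF (r / 2) (1 / 2)) (measurable_gammaPDFReal _ _).ennreal_ofReal
    (by simp [gammaPDF]),
    integral_congr_ae (gammaPDFReal_smul_eq_indicator hr h),
    integral_indicator measurableSet_Ioi, integral_const_mul]

lemma integrable_ncChiSq {r : ℝ} (hr : 0 < r) {h : ℝ → ℝ}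
    (hh : IntegrableOn (fun x => x ^ (r / 2 - 1) * exp (-(1 / 2) * x) * h x) (Set.Ioi 0)) :
    Integrable h (ncChiSq r 0) := by
  rw [ncChiSq_eq_gammaMeasure, gammaMeasure, integrable_withDensity_iff_integrable_smul'
    (f := gammaPDF (r / 2) (1 / 2)) (measurable_gammaPDFReal _ _).ennreal_ofReal
    (by simp [gammaPDF]),
    integrable_congr (gammaPDFReal_smul_eq_indicator hr h), integrable_indicator_iff
    measurableSet_Ioi]
  exact hh.const_mul _

lemma integrableOn_weight_mul_id {r : ℝ} (hr : 0 < r) :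
    IntegrableOn (fun x : ℝ => x ^ (r / 2 - 1) * exp (-(1 / 2) * x) * x) (Set.Ioi 0) := by
  refine (integrableOn_rpow_mul_exp_neg_half (s := r / 2) (by linarith)).congr_fun ?_
    measurableSet_Ioi
  intro x (hx : 0 < x)
  simp only
  rw [rpow_sub_one hx.ne']
  field_simp

lemma integrable_id_ncChiSq {r : ℝ} (hr : 0 < r) : Integrable (fun x : ℝ => x) (ncChiSq r 0) :=
  integrable_ncChiSq hr (integrableOn_weight_mul_id hr)

/-- Stein's identity for the chi-square distribution. -/
lemma integral_chiSq_stein {r : ℝ} (hr : 0 < r) {g g' : ℝ → ℝ} (hg : ∀ x, HasDerivAt g (g' x) x)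
    (hg' : Continuous g') {C : ℝ} (hC : ∀ x, |g x| ≤ C) (hC' : ∀ x, |g' x| ≤ C) :
    ∫ x, (2 * x * g' x + r * g x - x * g x) ∂(ncChiSq r 0) = 0 := by
  have hgc : Continuous g := continuous_iff_continuousAt.2 fun x => (hg x).continuousAt
  rw [integral_ncChiSq hr]
  refine mul_eq_zero_of_right _ ?_
  have hI := integral_Ioi_of_hasDerivAt_of_tendsto (a := 0) (m := 0)
    (f := fun x : ℝ => 2 * (x ^ (r / 2) * exp (-(1 / 2) * x) * g x))
    (f' := fun x => x ^ (r / 2 - 1) * exp (-(1 / 2) * x) * (2 * x * g' x + r * g x - x * g x))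
    ?_ ?_ ?_ ?_
  · rw [hI]
    simp [zero_rpow (by positivity : r / 2 ≠ 0)]
  · refine Continuous.continuousWithinAt ?_
    have : Continuous fun x : ℝ => x ^ (r / 2) := continuous_rpow_const (by positivity)
    fun_prop
  · intro x (hx : 0 < x)
    have h1 : HasDerivAt (fun x : ℝ => x ^ (r / 2)) (r / 2 * x ^ (r / 2 - 1)) x :=
      hasDerivAt_rpow_const (Or.inl hx.ne')
    have h2 : HasDerivAt (fun x : ℝ => exp (-(1 / 2) * x)) (exp (-(1 / 2) * x) * -(1 / 2)) x := by
      simpa using ((hasDerivAt_id x).const_mul (-(1 / 2) : ℝ)).exp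
    refine (((h1.mul h2).mul (hg x)).const_mul 2).congr_deriv ?_
    have h3 : x ^ (r / 2) = x ^ (r / 2 - 1) * x := by
      rw [rpow_sub_one hx.ne']; field_simp
    simp only [Pi.mul_apply]
    rw [h3]
    ring
  · have i0 := integrableOn_rpow_mul_exp_neg_half (s := r / 2 - 1) (by linarith)
    have i1 := integrableOn_weight_mul_id hr
    have a := Integrable.mul_bdd (c := C) i1 hg'.aestronglyMeasurable.restrict
      (.of_forall hC')
    have b := Integrable.mul_bdd (c := C) i0 hgc.aestronglyMeasurable.restrict
      (.of_forall hC)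
    have c := Integrable.mul_bdd (c := C) i1 hgc.aestronglyMeasurable.restrict
      (.of_forall hC)
    refine (((a.const_mul 2).add (b.const_mul r)).sub c).congr (.of_forall fun x => ?_)
    simp only [Pi.add_apply, Pi.sub_apply]
    ring
  · have h := (tendsto_rpow_mul_exp_neg_mul_atTop_nhds_zero (r / 2) (1 / 2) (by norm_num))
    have hb := h.zero_mul_isBoundedUnder_le (g := g)
      (Filter.isBoundedUnder_of ⟨C, fun x => hC x⟩)
    simpa using hb.const_mul 2

lemma isProbabilityMeasure_ncChiSqDiff {r : ℝ} (hr : 0 < r) :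
    IsProbabilityMeasure (ncChiSqDiff r 0 0) := by
  have := isProbabilityMeasure_ncChiSq hr
  exact Measure.isProbabilityMeasure_map (by fun_prop)

lemma integrable_id_ncChiSqDiff {r : ℝ} (hr : 0 < r) :
    Integrable (fun x : ℝ => x) (ncChiSqDiff r 0 0) := by
  have := isProbabilityMeasure_ncChiSq hr
  refine (integrable_map_measure (by fun_prop) (by fun_prop)).2 ?_
  exact ((integrable_id_ncChiSq hr).comp_fst _).sub ((integrable_id_ncChiSq hr).comp_snd _)

/-- Stein's identity for the chi-square difference, for functions with bounded derivatives up to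
order two. -/
lemma integral_chiSqDiff_stein_of_bounded {r : ℝ} (hr : 0 < r) {f f1 f2 : ℝ → ℝ}
    (hf : ∀ x, HasDerivAt f (f1 x) x) (hf1 : ∀ x, HasDerivAt f1 (f2 x) x) (hf2 : Continuous f2)
    {C : ℝ} (hC : ∀ x, |f x| ≤ C) (hC1 : ∀ x, |f1 x| ≤ C) (hC2 : ∀ x, |f2 x| ≤ C) :
    ∫ x, (4 * x * f2 x + 4 * r * f1 x - x * f x) ∂(ncChiSqDiff r 0 0) = 0 := by
  have := isProbabilityMeasure_ncChiSq hr
  have hfc : Continuous f := continuous_iff_continuousAt.2 fun x => (hf x).continuousAt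
  have hf1c : Continuous f1 := continuous_iff_continuousAt.2 fun x => (hf1 x).continuousAt
  have key : ∀ p : ℝ × ℝ, 4 * (p.1 - p.2) * f2 (p.1 - p.2) + 4 * r * f1 (p.1 - p.2)
      - (p.1 - p.2) * f (p.1 - p.2) =
      (2 * p.1 * (2 * f2 (p.1 - p.2) + f1 (p.1 - p.2)) + r * (2 * f1 (p.1 - p.2) + f (p.1 - p.2))
        - p.1 * (2 * f1 (p.1 - p.2) + f (p.1 - p.2))) +
      (2 * p.2 * (-2 * f2 (p.1 - p.2) + f1 (p.1 - p.2)) + r * (2 * f1 (p.1 - p.2) - f (p.1 - p.2))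
        - p.2 * (2 * f1 (p.1 - p.2) - f (p.1 - p.2))) := fun p => by ring
  have int : ∀ {X : ℝ × ℝ → ℝ}, Integrable X ((ncChiSq r 0).prod (ncChiSq r 0)) →
      ∀ {u : ℝ → ℝ}, Continuous u → (∃ K, ∀ x, |u x| ≤ K) →
      Integrable (fun p : ℝ × ℝ => X p * u (p.1 - p.2)) ((ncChiSq r 0).prod (ncChiSq r 0)) := by
    rintro X hX u hu ⟨K, hK⟩
    exact hX.mul_bdd (c := K) (by fun_prop) (.of_forall fun p => hK _)
  have bd : ∀ a b : ℝ, |a| ≤ C → |b| ≤ C → |2 * a + b| ≤ 3 * C ∧ |2 * a - b| ≤ 3 * C ∧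
      |-2 * a + b| ≤ 3 * C := by
    intro a b ha hb
    rw [abs_le] at ha hb
    refine ⟨abs_le.2 ?_, abs_le.2 ?_, abs_le.2 ?_⟩ <;> constructor <;> linarith
  have i1 := (integrable_id_ncChiSq hr).comp_fst (ncChiSq r 0)
  have i2 := (integrable_id_ncChiSq hr).comp_snd (ncChiSq r 0)
  have i0 := integrable_const (μ := (ncChiSq r 0).prod (ncChiSq r 0)) (1 : ℝ)
  have h1 : Integrable (fun p : ℝ × ℝ => 2 * p.1 * (2 * f2 (p.1 - p.2) + f1 (p.1 - p.2))
      + r * (2 * f1 (p.1 - p.2) + f (p.1 - p.2)) - p.1 * (2 * f1 (p.1 - p.2) + f (p.1 - p.2)))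
      ((ncChiSq r 0).prod (ncChiSq r 0)) :=
    (((int i1 (u := fun z => 2 * f2 z + f1 z) (by fun_prop)
          ⟨3 * C, fun x => (bd _ _ (hC2 _) (hC1 _)).1⟩).const_mul 2).add
        ((int i0 (u := fun z => 2 * f1 z + f z) (by fun_prop)
          ⟨3 * C, fun x => (bd _ _ (hC1 _) (hC _)).1⟩).const_mul r)).sub
        (int i1 (u := fun z => 2 * f1 z + f z) (by fun_prop)
          ⟨3 * C, fun x => (bd _ _ (hC1 _) (hC _)).1⟩) |>.congr
        (.of_forall fun p => by simp only [Pi.add_apply, Pi.sub_apply]; ring)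
  have h2 : Integrable (fun p : ℝ × ℝ => 2 * p.2 * (-2 * f2 (p.1 - p.2) + f1 (p.1 - p.2))
      + r * (2 * f1 (p.1 - p.2) - f (p.1 - p.2)) - p.2 * (2 * f1 (p.1 - p.2) - f (p.1 - p.2)))
      ((ncChiSq r 0).prod (ncChiSq r 0)) :=
    (((int i2 (u := fun z => -2 * f2 z + f1 z) (by fun_prop)
          ⟨3 * C, fun x => (bd _ _ (hC2 _) (hC1 _)).2.2⟩).const_mul 2).add
        ((int i0 (u := fun z => 2 * f1 z - f z) (by fun_prop)
          ⟨3 * C, fun x => (bd _ _ (hC1 _) (hC _)).2.1⟩).const_mul r)).sub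
        (int i2 (u := fun z => 2 * f1 z - f z) (by fun_prop)
          ⟨3 * C, fun x => (bd _ _ (hC1 _) (hC _)).2.1⟩) |>.congr
        (.of_forall fun p => by simp only [Pi.add_apply, Pi.sub_apply]; ring)
  rw [ncChiSqDiff, integral_map (by fun_prop) (by fun_prop)]
  simp_rw [key]
  rw [integral_add h1 h2, integral_prod_symm _ h1, integral_prod _ h2]
  have e1 : ∀ y : ℝ, ∫ x, (2 * x * (2 * f2 (x - y) + f1 (x - y))
      + r * (2 * f1 (x - y) + f (x - y)) - x * (2 * f1 (x - y) + f (x - y))) ∂(ncChiSq r 0)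
      = 0 := fun y =>
    integral_chiSq_stein hr (g := fun x => 2 * f1 (x - y) + f (x - y))
      (g' := fun x => 2 * f2 (x - y) + f1 (x - y))
      (fun x => (((hf1 _).comp_sub_const x y).const_mul 2).add ((hf _).comp_sub_const x y))
      (by fun_prop) (C := 3 * C) (fun x => (bd _ _ (hC1 _) (hC _)).1)
      (fun x => (bd _ _ (hC2 _) (hC1 _)).1)
  have e2 : ∀ x : ℝ, ∫ y, (2 * y * (-2 * f2 (x - y) + f1 (x - y))
      + r * (2 * f1 (x - y) - f (x - y)) - y * (2 * f1 (x - y) - f (x - y))) ∂(ncChiSq r 0)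
      = 0 := fun x =>
    integral_chiSq_stein hr (g := fun y => 2 * f1 (x - y) - f (x - y))
      (g' := fun y => -2 * f2 (x - y) + f1 (x - y))
      (fun y => ((((hf1 _).comp_const_sub x y).const_mul 2).sub
        ((hf _).comp_const_sub x y)).congr_deriv (by ring))
      (by fun_prop) (C := 3 * C) (fun y => (bd _ _ (hC1 _) (hC _)).2.1)
      (fun y => (bd _ _ (hC2 _) (hC1 _)).2.2)
  simp only [e1, e2, integral_zero, add_zero]

/-- A `C²` cutoff: equal to one at the origin, compactly supported, with its first two
derivatives. -/
lemma exists_cutoff : ∃ c c1 c2 : ℝ → ℝ, (∀ x, HasDerivAt c (c1 x) x) ∧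
    (∀ x, HasDerivAt c1 (c2 x) x) ∧ Continuous c2 ∧ c 0 = 1 ∧ HasCompactSupport c ∧
    HasCompactSupport c1 ∧ HasCompactSupport c2 := by
  let b : ContDiffBump (0 : ℝ) := ⟨1, 2, one_pos, one_lt_two⟩
  have hb : ContDiff ℝ 2 (b : ℝ → ℝ) := b.contDiff
  have hd : ContDiff ℝ 1 (deriv (b : ℝ → ℝ)) := hb.deriv' (n := 1)
  have hd' : ContDiff ℝ 0 (deriv (deriv (b : ℝ → ℝ))) := hd.deriv' (n := 0)
  refine ⟨b, deriv b, deriv (deriv b), fun x => ?_, fun x => ?_, hd'.continuous, ?_,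
    b.hasCompactSupport, b.hasCompactSupport.deriv, b.hasCompactSupport.deriv.deriv⟩
  · exact (hb.differentiable (by norm_num) x).hasDerivAt
  · exact (hd.differentiable (by norm_num) x).hasDerivAt
  · exact b.one_of_mem_closedBall (by simp [b])

/-- Stein's identity for the chi-square difference, under the weak integrability assumptions. -/
lemma integral_chiSqDiff_stein {r : ℝ} (hr : 0 < r) {f f1 f2 : ℝ → ℝ}
    (hf : ∀ x, HasDerivAt f (f1 x) x) (hf1 : ∀ x, HasDerivAt f1 (f2 x) x) (hf2 : Continuous f2)
    (i0 : Integrable f (ncChiSqDiff r 0 0)) (i1 : Integrable f1 (ncChiSqDiff r 0 0))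
    (j0 : Integrable (fun x => x * f x) (ncChiSqDiff r 0 0))
    (j1 : Integrable (fun x => x * f1 x) (ncChiSqDiff r 0 0))
    (j2 : Integrable (fun x => x * f2 x) (ncChiSqDiff r 0 0)) :
    ∫ x, (4 * x * f2 x + 4 * r * f1 x - x * f x) ∂(ncChiSqDiff r 0 0) = 0 := by
  obtain ⟨c, c1, c2, hc, hc1, hc2, c_zero, sc, sc1, sc2⟩ := exists_cutoff
  have hfc : Continuous f := continuous_iff_continuousAt.2 fun x => (hf x).continuousAt
  have hf1c : Continuous f1 := continuous_iff_continuousAt.2 fun x => (hf1 x).continuousAt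
  have hcc : Continuous c := continuous_iff_continuousAt.2 fun x => (hc x).continuousAt
  have hc1c : Continuous c1 := continuous_iff_continuousAt.2 fun x => (hc1 x).continuousAt
  obtain ⟨K0, hK0⟩ := sc.exists_bound_of_continuous hcc
  obtain ⟨K1, hK1⟩ := sc1.exists_bound_of_continuous hc1c
  obtain ⟨K2, hK2⟩ := sc2.exists_bound_of_continuous hc2
  obtain ⟨K, l0, l1, l2⟩ : ∃ K, K0 ≤ K ∧ K1 ≤ K ∧ K2 ≤ K :=
    ⟨max K0 (max K1 K2), by simp, by simp, by simp⟩
  let e : ℕ → ℝ := fun n => 1 / ((n : ℝ) + 1)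
  have he : ∀ n, 0 < e n := fun n => by positivity
  have he1 : ∀ n, e n ≤ 1 := fun n => by
    simp only [e]
    rw [div_le_one (by positivity)]
    linarith [(Nat.cast_nonneg n : (0 : ℝ) ≤ n)]
  have het : Filter.Tendsto e Filter.atTop (nhds 0) := tendsto_one_div_add_atTop_nhds_zero_nat
  let F : ℕ → ℝ → ℝ := fun n x => 4 * x * (f2 x * c (e n * x) + 2 * (f1 x * (e n * c1 (e n * x)))
      + f x * (e n * (e n * c2 (e n * x)))) +
      4 * r * (f1 x * c (e n * x) + f x * (e n * c1 (e n * x))) - x * (f x * c (e n * x))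
  have hF0 : ∀ n, ∫ x, F n x ∂(ncChiSqDiff r 0 0) = 0 := by
    intro n
    have hs : ∀ {u : ℝ → ℝ}, HasCompactSupport u → HasCompactSupport fun x => u (e n * x) :=
      fun hu => hu.comp_homeomorph (Homeomorph.mulLeft₀ (e n) (he n).ne')
    have d : ∀ x, HasDerivAt (fun x => e n * x) (e n) x := fun x => by
      simpa using (hasDerivAt_id x).const_mul (e n)
    have d0 : ∀ x, HasDerivAt (fun x => c (e n * x)) (e n * c1 (e n * x)) x := fun x =>
      ((hc _).comp x (d x)).congr_deriv (mul_comm _ _)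
    have d1 : ∀ x, HasDerivAt (fun x => e n * c1 (e n * x)) (e n * (e n * c2 (e n * x))) x :=
      fun x => (((hc1 _).comp x (d x)).const_mul (e n)).congr_deriv (by ring)
    have t0 : HasCompactSupport fun x => f x * c (e n * x) := (hs sc).mul_left
    have t1 : HasCompactSupport fun x => f1 x * c (e n * x) + f x * (e n * c1 (e n * x)) :=
      (hs sc).mul_left.add (hs sc1).mul_left.mul_left
    have t2 : HasCompactSupport fun x => f2 x * c (e n * x) + 2 * (f1 x * (e n * c1 (e n * x)))
        + f x * (e n * (e n * c2 (e n * x))) :=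
      ((hs sc).mul_left.add (hs sc1).mul_left.mul_left.mul_left).add
        (hs sc2).mul_left.mul_left.mul_left
    obtain ⟨B0, hB0⟩ := t0.exists_bound_of_continuous (by fun_prop)
    obtain ⟨B1, hB1⟩ := t1.exists_bound_of_continuous (by fun_prop)
    obtain ⟨B2, hB2⟩ := t2.exists_bound_of_continuous (by fun_prop)
    refine integral_chiSqDiff_stein_of_bounded hr (f := fun x => f x * c (e n * x))
      (f1 := fun x => f1 x * c (e n * x) + f x * (e n * c1 (e n * x)))
      (f2 := fun x => f2 x * c (e n * x) + 2 * (f1 x * (e n * c1 (e n * x)))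
        + f x * (e n * (e n * c2 (e n * x))))
      (fun x => (hf x).mul (d0 x))
      (fun x => (((hf1 x).mul (d0 x)).add ((hf x).mul (d1 x))).congr_deriv (by ring))
      (by fun_prop) (C := max B0 (max B1 B2)) (fun x => (hB0 x).trans (by simp))
      (fun x => (hB1 x).trans (by simp)) (fun x => (hB2 x).trans (by simp))
  have hlim := tendsto_integral_of_dominated_convergence (μ := ncChiSqDiff r 0 0) (F := F)
    (f := fun x => 4 * x * f2 x + 4 * r * f1 x - x * f x)
    (fun x => 4 * K * |x * f2 x| + 8 * K * |x * f1 x| + 4 * K * |x * f x| + 4 * r * K * |f1 x| +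
      4 * r * K * |f x| + K * |x * f x|) ?_ ?_ ?_ ?_
  · simp only [hF0] at hlim
    exact (tendsto_nhds_unique hlim tendsto_const_nhds)
  · intro n
    exact Continuous.aestronglyMeasurable (by fun_prop)
  · exact (((((j2.abs.const_mul _).add (j1.abs.const_mul _)).add (j0.abs.const_mul _)).add
      (i1.abs.const_mul _)).add (i0.abs.const_mul _)).add (j0.abs.const_mul _)
  · intro n
    refine .of_forall fun x => ?_
    have b0 : |c (e n * x)| ≤ K := (hK0 _).trans l0
    have b1 : |e n * c1 (e n * x)| ≤ K := by
      rw [abs_mul, abs_of_pos (he n)]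
      exact (mul_le_of_le_one_left (abs_nonneg _) (he1 n)).trans ((hK1 _).trans l1)
    have b2 : |e n * (e n * c2 (e n * x))| ≤ K := by
      rw [abs_mul, abs_mul, abs_of_pos (he n)]
      refine (mul_le_of_le_one_left (by have := he n; positivity) (he1 n)).trans ?_
      exact (mul_le_of_le_one_left (abs_nonneg _) (he1 n)).trans ((hK2 _).trans l2)
    have m : ∀ a b : ℝ, |b| ≤ K → |a * b| ≤ K * |a| := fun a b hb => by
      rw [abs_mul, mul_comm]
      exact mul_le_mul_of_nonneg_right hb (abs_nonneg _)
    have s1 := abs_le.1 (m (x * f2 x) _ b0)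
    have s2 := abs_le.1 (m (x * f1 x) _ b1)
    have s3 := abs_le.1 (m (x * f x) _ b2)
    have s4 := abs_le.1 (m (r * f1 x) _ b0)
    have s5 := abs_le.1 (m (r * f x) _ b1)
    have s6 := abs_le.1 (m (x * f x) _ b0)
    rw [abs_mul r, abs_of_pos hr] at s4 s5
    rw [Real.norm_eq_abs, abs_le]
    constructor <;> simp only [F] <;> linarith
  · refine .of_forall fun x => ?_
    have hex : Filter.Tendsto (fun n => e n * x) Filter.atTop (nhds 0) := by
      simpa using het.mul_const x
    have q0 : Filter.Tendsto (fun n => c (e n * x)) Filter.atTop (nhds 1) :=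
      c_zero ▸ (hcc.tendsto 0).comp hex
    have q1 : Filter.Tendsto (fun n => e n * c1 (e n * x)) Filter.atTop (nhds 0) := by
      simpa using het.mul ((hc1c.tendsto 0).comp hex)
    have q2 : Filter.Tendsto (fun n => e n * (e n * c2 (e n * x))) Filter.atTop (nhds 0) := by
      simpa using het.mul (het.mul ((hc2.tendsto 0).comp hex))
    have := (((((q0.const_mul (f2 x)).add ((q1.const_mul (f1 x)).const_mul 2)).add
      (q2.const_mul (f x))).const_mul (4 * x)).add
      (((q0.const_mul (f1 x)).add (q1.const_mul (f x))).const_mul (4 * r))).sub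
      ((q0.const_mul (f x)).const_mul x)
    simpa using this

/-- A probability measure with finite mean satisfying the Stein identity for sines and cosines has
characteristic function `t ↦ (1 + 4 t²) ^ (-r / 2)`. -/
lemma charFun_eq_of_stein {r : ℝ} {μ : Measure ℝ} [IsProbabilityMeasure μ]
    (hμ : Integrable (fun x : ℝ => x) μ)
    (hcos : ∀ t : ℝ, ∫ x, (4 * x * (-(t ^ 2) * cos (t * x)) + 4 * r * (-t * sin (t * x))
      - x * cos (t * x)) ∂μ = 0)
    (hsin : ∀ t : ℝ, ∫ x, (4 * x * (-(t ^ 2) * sin (t * x)) + 4 * r * (t * cos (t * x))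
      - x * sin (t * x)) ∂μ = 0) (t : ℝ) :
    charFun μ t = (((1 + 4 * t ^ 2) ^ (-(r / 2)) : ℝ) : ℂ) := by
  have hmem : MemLp id ((1 : ℕ) : ENNReal) μ := by
    rw [Nat.cast_one]
    exact memLp_one_iff_integrable.2 hμ
  have hdiff : Differentiable ℝ (charFun μ) :=
    (contDiff_charFun hmem).differentiable (by norm_num)
  have hder : ∀ t : ℝ, deriv (charFun μ) t =
      Complex.I * ∫ x : ℝ, (x : ℂ) * Complex.exp (t * x * Complex.I) ∂μ := by
    intro t
    have := iteratedDeriv_charFun (n := 1) (t := t) hmem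
    simpa [iteratedDeriv_one] using this
  have hode : ∀ t : ℝ, (1 + 4 * (t : ℂ) ^ 2) * deriv (charFun μ) t
      = -(4 * r * t) * charFun μ t := by
    intro t
    have ie : Integrable (fun x : ℝ => Complex.exp (t * x * Complex.I)) μ := by
      refine (integrable_const (1 : ℝ)).mono' (by fun_prop) (.of_forall fun x => ?_)
      rw [← Complex.ofReal_mul, Complex.norm_exp_ofReal_mul_I]
    have ixe : Integrable (fun x : ℝ => (x : ℂ) * Complex.exp (t * x * Complex.I)) μ := by
      refine hμ.ofReal.mul_bdd (c := 1) (by fun_prop) (.of_forall fun x => ?_)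
      rw [← Complex.ofReal_mul, Complex.norm_exp_ofReal_mul_I]
    have iG := (ixe.const_mul (-(1 + 4 * (t : ℂ) ^ 2))).add (ie.const_mul (4 * r * t * Complex.I))
    have hG := integral_re_add_im iG
    have hexp : ∀ x : ℝ, Complex.exp (t * x * Complex.I) =
        ((cos (t * x) : ℝ) : ℂ) + ((sin (t * x) : ℝ) : ℂ) * Complex.I := by
      intro x
      rw [Complex.exp_mul_I]
      push_cast
      rfl
    have hform : ∀ x : ℝ, -(1 + 4 * (t : ℂ) ^ 2) * ((x : ℂ) * Complex.exp (t * x * Complex.I)) +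
        4 * r * t * Complex.I * Complex.exp (t * x * Complex.I) =
        ((4 * x * (-(t ^ 2) * cos (t * x)) + 4 * r * (-t * sin (t * x))
          - x * cos (t * x) : ℝ) : ℂ) +
        ((4 * x * (-(t ^ 2) * sin (t * x)) + 4 * r * (t * cos (t * x))
          - x * sin (t * x) : ℝ) : ℂ) * Complex.I := by
      intro x
      rw [hexp]
      push_cast
      linear_combination (4 * r * t * Complex.sin (t * x)) * Complex.I_sq
    have hz : ∫ x : ℝ, (-(1 + 4 * (t : ℂ) ^ 2) * ((x : ℂ) * Complex.exp (t * x * Complex.I)) +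
        4 * r * t * Complex.I * Complex.exp (t * x * Complex.I)) ∂μ = 0 := by
      refine hG.symm.trans ?_
      simp only [Pi.add_apply, hform]
      simp only [RCLike.re_to_complex, RCLike.im_to_complex, Complex.add_re, Complex.add_im,
        Complex.ofReal_re, Complex.ofReal_im, Complex.re_ofReal_mul, Complex.im_ofReal_mul,
        Complex.I_re, Complex.I_im, mul_zero, mul_one, add_zero, zero_add, hcos, hsin]
      simp
    rw [integral_add (ixe.const_mul _) (ie.const_mul _), integral_const_mul,
      integral_const_mul, ← charFun_apply_real] at hz
    rw [hder]
    linear_combination (-Complex.I) * hz + (4 * r * t * charFun μ t) * Complex.I_sq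
  have hpos : ∀ t : ℝ, 0 < 1 + 4 * t ^ 2 := fun t => by positivity
  have hw : ∀ t : ℝ, HasDerivAt (fun t : ℝ => (((1 + 4 * t ^ 2) ^ (r / 2) : ℝ) : ℂ))
      ((4 * r * t * (1 + 4 * t ^ 2) ^ (r / 2 - 1) : ℝ) : ℂ) t := by
    intro t
    have h1 : HasDerivAt (fun t : ℝ => 1 + 4 * t ^ 2) (8 * t) t :=
      (((hasDerivAt_pow 2 t).const_mul 4).const_add 1).congr_deriv (by norm_num; ring)
    exact ((h1.rpow_const (p := r / 2) (Or.inl (hpos t).ne')).congr_deriv (by ring)).ofReal_comp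
  have hprod : ∀ t : ℝ, HasDerivAt
      (fun t : ℝ => charFun μ t * (((1 + 4 * t ^ 2) ^ (r / 2) : ℝ) : ℂ)) 0 t := by
    intro t
    refine ((hdiff t).hasDerivAt.mul (hw t)).congr_deriv ?_
    have h3 : (1 + 4 * t ^ 2) ^ (r / 2) = (1 + 4 * t ^ 2) ^ (r / 2 - 1) * (1 + 4 * t ^ 2) := by
      rw [rpow_sub_one (hpos t).ne']
      have := (hpos t).ne'
      field_simp
    rw [h3]
    push_cast
    linear_combination (((1 + 4 * t ^ 2) ^ (r / 2 - 1) : ℝ) : ℂ) * hode t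
  have hconst := is_const_of_deriv_eq_zero (fun t => (hprod t).differentiableAt)
    (fun t => (hprod t).deriv) t 0
  have hone : charFun μ t * (((1 + 4 * t ^ 2) ^ (r / 2) : ℝ) : ℂ) = 1 := by
    simpa using hconst
  rw [rpow_neg (hpos t).le, Complex.ofReal_inv]
  exact eq_inv_of_mul_eq_one_left hone

lemma hasDerivAt_cos_const_mul (t x : ℝ) :
    HasDerivAt (fun x => cos (t * x)) (-t * sin (t * x)) x :=
  ((hasDerivAt_id x).const_mul t).cos.congr_deriv (by simp; ring)

lemma hasDerivAt_sin_const_mul (t x : ℝ) :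
    HasDerivAt (fun x => sin (t * x)) (t * cos (t * x)) x :=
  ((hasDerivAt_id x).const_mul t).sin.congr_deriv (by simp; ring)

lemma hasDerivAt_neg_mul_sin_const_mul (t x : ℝ) :
    HasDerivAt (fun x => -t * sin (t * x)) (-(t ^ 2) * cos (t * x)) x :=
  ((hasDerivAt_sin_const_mul t x).const_mul (-t)).congr_deriv (by ring)

lemma hasDerivAt_mul_cos_const_mul (t x : ℝ) :
    HasDerivAt (fun x => t * cos (t * x)) (-(t ^ 2) * sin (t * x)) x :=
  ((hasDerivAt_cos_const_mul t x).const_mul t).congr_deriv (by ring)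

lemma iteratedDeriv_one_and_two_eq {f f1 f2 : ℝ → ℝ} (hf : ∀ x, HasDerivAt f (f1 x) x)
    (hf1 : ∀ x, HasDerivAt f1 (f2 x) x) :
    iteratedDeriv 1 f = f1 ∧ iteratedDeriv 2 f = f2 := by
  have h1 : deriv f = f1 := funext fun x => (hf x).deriv
  have h2 : deriv f1 = f2 := funext fun x => (hf1 x).deriv
  refine ⟨by rw [iteratedDeriv_one, h1], ?_⟩
  rw [iteratedDeriv_succ, iteratedDeriv_one, h1, h2]

lemma abs_mul_trig_le {a s : ℝ} (hs : |s| ≤ 1) : |a * s| ≤ |a| := by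
  rw [abs_mul]
  exact mul_le_of_le_one_right (abs_nonneg _) hs

/-- The chi-square difference has characteristic function `t ↦ (1 + 4 t²) ^ (-r / 2)`. -/
lemma charFun_ncChiSqDiff {r : ℝ} (hr : 0 < r) (t : ℝ) :
    charFun (ncChiSqDiff r 0 0) t = (((1 + 4 * t ^ 2) ^ (-(r / 2)) : ℝ) : ℂ) := by
  have := isProbabilityMeasure_ncChiSqDiff hr
  refine charFun_eq_of_stein (integrable_id_ncChiSqDiff hr) (fun t => ?_) (fun t => ?_) t
  · refine integral_chiSqDiff_stein_of_bounded hr (hasDerivAt_cos_const_mul t)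
      (hasDerivAt_neg_mul_sin_const_mul t) (by fun_prop) (C := max 1 (max |-t| |-(t ^ 2)|))
      (fun x => (abs_cos_le_one _).trans (by simp))
      (fun x => (abs_mul_trig_le (abs_sin_le_one _)).trans (le_max_of_le_right (le_max_left _ _)))
      (fun x => (abs_mul_trig_le (abs_cos_le_one _)).trans (le_max_of_le_right (le_max_right _ _)))
  · refine integral_chiSqDiff_stein_of_bounded hr (hasDerivAt_sin_const_mul t)
      (hasDerivAt_mul_cos_const_mul t) (by fun_prop) (C := max 1 (max |t| |-(t ^ 2)|))
      (fun x => (abs_sin_le_one _).trans (by simp))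
      (fun x => (abs_mul_trig_le (abs_cos_le_one _)).trans (le_max_of_le_right (le_max_left _ _)))
      (fun x => (abs_mul_trig_le (abs_sin_le_one _)).trans (le_max_of_le_right (le_max_right _ _)))

/-- Stein characterisation of the (central) chi-square difference
distribution. Let `T = V₁ - V₂` with `V₁, V₂` independent, each with law `χ'²_r(0)`, `r > 0`,
and let `W` be a real-valued random variable with `E|W| < ∞`. With
`A₃ f (x) = 4x f″(x) + 4r f′(x) - x f(x)`, we have `W =_d T` iff `E[A₃ f (W)] = 0` for all
`f ∈ F₂(W)`. -/
theorem chiSqDiff_stein_characterisation {Ω : Type*} [MeasurableSpace Ω]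
    (P : Measure Ω) [IsProbabilityMeasure P] (r : ℝ) (hr : 0 < r)
    (W : Ω → ℝ) (hW : Measurable W) (hWint : Integrable W P) :
    Measure.map W P = ncChiSqDiff r 0 0 ↔
      ∀ f : ℝ → ℝ, ContDiff ℝ 2 f →
        (∀ j : ℕ, j ≤ 1 → Integrable (fun ω => iteratedDeriv j f (W ω)) P) →
        (∀ j : ℕ, j ≤ 2 → Integrable (fun ω => W ω * iteratedDeriv j f (W ω)) P) →
        ∫ ω, (4 * W ω * iteratedDeriv 2 f (W ω) + 4 * r * iteratedDeriv 1 f (W ω)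
            - W ω * f (W ω)) ∂P = 0 := by
  have hfin := isProbabilityMeasure_ncChiSqDiff hr
  constructor
  · intro hlaw f hf hi hj
    have hd1 : ContDiff ℝ 1 (deriv f) := hf.deriv' (n := 1)
    have hd2 : ContDiff ℝ 0 (deriv (deriv f)) := hd1.deriv' (n := 0)
    have hf' : ∀ x, HasDerivAt f (deriv f x) x := fun x =>
      (hf.differentiable (by norm_num) x).hasDerivAt
    have hf'' : ∀ x, HasDerivAt (deriv f) (deriv (deriv f) x) x := fun x =>
      (hd1.differentiable (by norm_num) x).hasDerivAt
    obtain ⟨e1, e2⟩ := iteratedDeriv_one_and_two_eq hf' hf''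
    have hc0 := hf.continuous
    have hc1 := hd1.continuous
    have hc2 := hd2.continuous
    have tr : ∀ {g : ℝ → ℝ}, Continuous g → Integrable (fun ω => g (W ω)) P →
        Integrable g (ncChiSqDiff r 0 0) := by
      intro g hg hgi
      rw [← hlaw]
      exact (integrable_map_measure hg.aestronglyMeasurable hW.aemeasurable).2 hgi
    have i0 := hi 0 (by norm_num)
    have i1 := hi 1 le_rfl
    have j0 := hj 0 (by norm_num)
    have j1 := hj 1 (by norm_num)
    have j2 := hj 2 le_rfl
    rw [iteratedDeriv_zero] at i0 j0
    rw [e1] at i1 j1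
    rw [e2] at j2
    have h := integral_chiSqDiff_stein hr hf' hf'' hc2 (tr hc0 i0) (tr hc1 i1)
      (tr (g := fun x => x * f x) (by fun_prop) j0)
      (tr (g := fun x => x * deriv f x) (by fun_prop) j1)
      (tr (g := fun x => x * deriv (deriv f) x) (by fun_prop) j2)
    rw [← hlaw, integral_map hW.aemeasurable
      (Continuous.aestronglyMeasurable (by fun_prop))] at h
    rw [e1, e2]
    exact h
  · intro h
    have := Measure.isProbabilityMeasure_map (μ := P) hW.aemeasurable
    have stein : ∀ {f f1 f2 : ℝ → ℝ}, ContDiff ℝ 2 f → (∀ x, HasDerivAt f (f1 x) x) →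
        (∀ x, HasDerivAt f1 (f2 x) x) → Continuous f2 → (∃ C, ∀ x, |f x| ≤ C) →
        (∃ C, ∀ x, |f1 x| ≤ C) → (∃ C, ∀ x, |f2 x| ≤ C) →
        ∫ x, (4 * x * f2 x + 4 * r * f1 x - x * f x) ∂(Measure.map W P) = 0 := by
      rintro f f1 f2 hf hf' hf'' hc2 ⟨C, hC⟩ ⟨C1, hC1⟩ ⟨C2, hC2⟩
      obtain ⟨e1, e2⟩ := iteratedDeriv_one_and_two_eq hf' hf''
      have hc0 : Continuous f := hf.continuous
      have hc1 : Continuous f1 := continuous_iff_continuousAt.2 fun x => (hf'' x).continuousAt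
      have bi : ∀ {X : Ω → ℝ}, Integrable X P → ∀ {u : ℝ → ℝ} {K : ℝ}, Continuous u →
          (∀ x, |u x| ≤ K) → Integrable (fun ω => X ω * u (W ω)) P := fun hX u K hu hK =>
        hX.mul_bdd (c := K) (hu.measurable.comp hW).aestronglyMeasurable
          (.of_forall fun ω => hK _)
      have := h f hf (fun j hj => ?_) (fun j hj => ?_)
      · rw [integral_map hW.aemeasurable (Continuous.aestronglyMeasurable (by fun_prop))]
        rwa [e1, e2] at this
      · interval_cases j
        · rw [iteratedDeriv_zero]
          simpa using bi (integrable_const 1) hc0 hC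
        · rw [e1]
          simpa using bi (integrable_const 1) hc1 hC1
      · interval_cases j
        · rw [iteratedDeriv_zero]
          exact bi hWint hc0 hC
        · rw [e1]
          exact bi hWint hc1 hC1
        · rw [e2]
          exact bi hWint hc2 hC2
    have hid : Integrable (fun x : ℝ => x) (Measure.map W P) :=
      (integrable_map_measure (by fun_prop) hW.aemeasurable).2 hWint
    refine Measure.ext_of_charFun (funext fun t => ?_)
    rw [charFun_ncChiSqDiff hr]
    refine charFun_eq_of_stein hid (fun t => ?_) (fun t => ?_) t
    · exact stein (by fun_prop) (hasDerivAt_cos_const_mul t)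
        (hasDerivAt_neg_mul_sin_const_mul t) (by fun_prop) ⟨1, fun x => abs_cos_le_one _⟩
        ⟨_, fun x => abs_mul_trig_le (abs_sin_le_one _)⟩
        ⟨_, fun x => abs_mul_trig_le (abs_cos_le_one _)⟩
    · exact stein (by fun_prop) (hasDerivAt_sin_const_mul t)
        (hasDerivAt_mul_cos_const_mul t) (by fun_prop) ⟨1, fun x => abs_sin_le_one _⟩
        ⟨_, fun x => abs_mul_trig_le (abs_cos_le_one _)⟩
        ⟨_, fun x => abs_mul_trig_le (abs_sin_le_one _)⟩

end
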